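/- Let K be a field, q a nonzero element of K, and x an m×n q-matrix with entries in an associative unital K-algebra A. Let 1 ≤ i < j < k ≤ n, let X ⊆ {1,…,n} − {i,j,k}, and suppose m ≥ |X| + 2. Then the flag quantum minors satisfy [Xik]·[Xj] = q⁻¹ [Xij]·[Xk] + q [Xjk]·[Xi]. -/

import Mathlib

/-- Number of inversions of a permutation of `Fin k`. -/
def permInversions {k : ℕ} (σ : Equiv.Perm (Fin k)) : ℕ :=
  (Finset.univ.filter (fun p : Fin k × Fin k => p.1 < p.2 ∧ σ p.2 < σ p.1)).card

/-- The quantum minor `[I|J]_q` of a matrix `x` (indexed by `ℕ`, rows/columns `1,…`),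
with row set `I` and column set `J` (both listed in increasing order). -/
noncomputable def qMinor {K : Type} [Field K] {A : Type} [Ring A] [Algebra K A]
    (q : K) (x : ℕ → ℕ → A) (I J : Finset ℕ) : A :=
  if h : I.card = J.card then
    ∑ σ : Equiv.Perm (Fin I.card),
      ((-q) ^ permInversions σ) •
        (List.ofFn (fun d : Fin I.card =>
          x (I.orderEmbOfFin rfl d) (J.orderEmbOfFin h.symm (σ d)))).prod
  else 0

/-- The flag quantum minor `[J]_q := [{1,…,|J|} | J]_q`. -/
noncomputable def flagMinor {K : Type} [Field K] {A : Type} [Ring A] [Algebra K A]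
    (q : K) (x : ℕ → ℕ → A) (J : Finset ℕ) : A :=
  qMinor q x (Finset.Icc 1 J.card) J

/-- Manin's relations: `x` is an `m × n` `q`-matrix. -/
def IsQMatrix {K : Type} [Field K] {A : Type} [Ring A] [Algebra K A]
    (q : K) (m n : ℕ) (x : ℕ → ℕ → A) : Prop :=
  (∀ i j k, 1 ≤ i → i ≤ m → 1 ≤ j → j < k → k ≤ n →
    x i j * x i k = q • (x i k * x i j)) ∧
  (∀ i l j, 1 ≤ i → i < l → l ≤ m → 1 ≤ j → j ≤ n →
    x i j * x l j = q • (x l j * x i j)) ∧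
  (∀ i l j k, 1 ≤ i → i < l → l ≤ m → 1 ≤ j → j < k → k ≤ n →
    x i k * x l j = x l j * x i k) ∧
  (∀ i l j k, 1 ≤ i → i < l → l ≤ m → 1 ≤ j → j < k → k ≤ n →
    x i j * x l k - x l k * x i j = (q - q⁻¹) • (x i k * x l j))

open Finset

/-- The number of elements of `C` below `c`. -/
def numBelow (C : Finset ℕ) (c : ℕ) : ℕ := #{d ∈ C | d < c}

/-- The number of elements of `C` above `c`. -/
def numAbove (C : Finset ℕ) (c : ℕ) : ℕ := #{d ∈ C | c < d}

lemma numBelow_eq_erase {C : Finset ℕ} {a : ℕ} (ha : a ∈ C) (c : ℕ) :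
    numBelow C c = numBelow (C.erase a) c + if a < c then 1 else 0 := by
  unfold numBelow
  rw [filter_erase]
  split_ifs with h
  · rw [card_erase_add_one (by simp [ha, h])]
  · rw [erase_eq_of_notMem (by simp [h]), add_zero]

lemma numAbove_eq_erase {C : Finset ℕ} {a : ℕ} (ha : a ∈ C) (c : ℕ) :
    numAbove C c = numAbove (C.erase a) c + if c < a then 1 else 0 := by
  unfold numAbove
  rw [filter_erase]
  split_ifs with h
  · rw [card_erase_add_one (by simp [ha, h])]
  · rw [erase_eq_of_notMem (by simp [h]), add_zero]

section RowExpansion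

variable {K A : Type} [Field K] [Ring A] [Algebra K A]

/-- The row-ordered quantum determinant of the rows listed in `rs` (in any order, possibly with
repetitions) and the columns in `C`, defined by expansion along the first row of the list. -/
noncomputable def rowMinor (q : K) (x : ℕ → ℕ → A) : List ℕ → Finset ℕ → A
  | [], C => if C = ∅ then 1 else 0
  | r :: rs, C => ∑ c ∈ C, (-q) ^ numBelow C c • (x r c * rowMinor q x rs (C.erase c))

variable {q : K} {x : ℕ → ℕ → A} {m n : ℕ}

lemma rowMinor_nil (C : Finset ℕ) : rowMinor q x [] C = if C = ∅ then 1 else 0 := rfl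

lemma rowMinor_cons (r : ℕ) (rs : List ℕ) (C : Finset ℕ) :
    rowMinor q x (r :: rs) C =
      ∑ c ∈ C, (-q) ^ numBelow C c • (x r c * rowMinor q x rs (C.erase c)) := rfl

lemma rowMinor_cons_empty (r : ℕ) (rs : List ℕ) : rowMinor q x (r :: rs) ∅ = 0 := rfl

lemma rowMinor_append_singleton (rs : List ℕ) (t : ℕ) (C : Finset ℕ) :
    rowMinor q x (rs ++ [t]) C =
      ∑ c ∈ C, (-q) ^ numAbove C c • (rowMinor q x rs (C.erase c) * x t c) := by
  induction rs generalizing C with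
  | nil =>
    rw [List.nil_append, rowMinor_cons]
    refine sum_congr rfl fun c hc => ?_
    by_cases h : C.erase c = ∅
    · rw [numBelow_eq_erase hc, numAbove_eq_erase hc, h]
      simp [rowMinor, numBelow, numAbove]
    · simp [rowMinor, h]
  | cons r rs ih =>
    simp only [List.cons_append, rowMinor_cons, ih, mul_sum, sum_mul, smul_sum]
    rw [sum_comm' (t' := C) (s' := fun c => C.erase c)
      (by intro a b; simp only [mem_erase]; grind)]
    refine sum_congr rfl fun c hc => sum_congr rfl fun d hd => ?_
    obtain ⟨hdc, hd⟩ := mem_erase.mp hd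
    rw [mul_smul_comm, smul_smul, smul_mul_assoc, smul_smul, erase_right_comm, mul_assoc,
      ← pow_add, ← pow_add]
    congr 2
    rw [numBelow_eq_erase hc d, numAbove_eq_erase hd c]
    ring

lemma sum_erase_eq_sum_lt {M : Type*} [AddCommMonoid M] (C : Finset ℕ) (f : ℕ → ℕ → M) :
    ∑ c ∈ C, ∑ d ∈ C.erase c, f c d = ∑ c ∈ C, ∑ d ∈ C with c < d, (f c d + f d c) := by
  have h : ∀ c ∈ C, ∑ d ∈ C.erase c, f c d =
      ∑ d ∈ C with c < d, f c d + ∑ d ∈ C with d < c, f c d := by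
    intro c _
    rw [← sum_union (by rw [disjoint_left]; simp; grind)]
    refine sum_congr ?_ fun _ _ => rfl
    ext d
    simp only [mem_erase, mem_union, mem_filter]
    grind
  rw [sum_congr rfl h]
  simp only [sum_add_distrib]
  congr 1
  exact sum_comm' (by intro a b; simp only [mem_filter]; grind)

lemma rowMinor_cons_cons (r s : ℕ) (rs : List ℕ) (C : Finset ℕ) :
    rowMinor q x (r :: s :: rs) C = ∑ c ∈ C, ∑ d ∈ C with c < d,
      (-q) ^ (numBelow (C.erase d) c + numBelow (C.erase c) d) •
        ((x r c * x s d - q • (x r d * x s c)) * rowMinor q x rs ((C.erase c).erase d)) := by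
  simp only [rowMinor_cons, mul_sum, smul_sum]
  rw [sum_erase_eq_sum_lt C fun c d => (-q) ^ numBelow C c •
    (x r c * ((-q) ^ numBelow (C.erase c) d • (x s d * rowMinor q x rs ((C.erase c).erase d))))]
  refine sum_congr rfl fun c hc => sum_congr rfl fun d hd => ?_
  obtain ⟨hd, hcd⟩ := mem_filter.mp hd
  rw [numBelow_eq_erase hd c, numBelow_eq_erase hc d, if_pos hcd, if_neg hcd.not_gt,
    erase_right_comm (a := d)]
  simp only [mul_smul_comm, smul_smul, ← mul_assoc, sub_mul, smul_mul_assoc, smul_sub]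
  rw [sub_eq_add_neg, ← neg_smul]
  congr 2 <;> ring

lemma rowMinor_cons_self (hx : IsQMatrix q m n x) {r : ℕ} (hr : r ∈ Icc 1 m) (rs : List ℕ)
    {C : Finset ℕ} (hC : C ⊆ Icc 1 n) : rowMinor q x (r :: r :: rs) C = 0 := by
  rw [rowMinor_cons_cons]
  refine sum_eq_zero fun c hc => sum_eq_zero fun d hd => ?_
  obtain ⟨hd, hcd⟩ := mem_filter.mp hd
  have hc := mem_Icc.mp (hC hc)
  have hd := mem_Icc.mp (hC hd)
  have hr := mem_Icc.mp hr
  rw [hx.1 r c d hr.1 hr.2 hc.1 hcd hd.2, sub_self, zero_mul, smul_zero]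

lemma rowMinor_swap (hq : q ≠ 0) (hx : IsQMatrix q m n x) {r s : ℕ} (hr : 1 ≤ r) (hrs : r < s)
    (hs : s ≤ m) (rs : List ℕ) {C : Finset ℕ} (hC : C ⊆ Icc 1 n) :
    rowMinor q x (s :: r :: rs) C = -q • rowMinor q x (r :: s :: rs) C := by
  simp only [rowMinor_cons_cons, smul_sum]
  refine sum_congr rfl fun c hc => sum_congr rfl fun d hd => ?_
  obtain ⟨hd, hcd⟩ := mem_filter.mp hd
  have hc := mem_Icc.mp (hC hc)
  have hd := mem_Icc.mp (hC hd)
  have h3 := hx.2.2.1 r s c d hr hrs hs hc.1 hcd hd.2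
  have h4 := hx.2.2.2 r s c d hr hrs hs hc.1 hcd hd.2
  rw [smul_comm (-q), ← smul_mul_assoc (-q)]
  congr 2
  rw [sub_eq_iff_eq_add'.mp h4, ← h3]
  match_scalars <;> field_simp
  ring

/-- A row that reappears after rows with larger indices kills the determinant. -/
lemma rowMinor_eq_zero_of_lt (hq : q ≠ 0) (hx : IsQMatrix q m n x) {t : ℕ} (ht : 1 ≤ t)
    (l rs : List ℕ) (hl : ∀ y ∈ l, t < y ∧ y ≤ m) (htm : t ≤ m) {C : Finset ℕ}
    (hC : C ⊆ Icc 1 n) : rowMinor q x (t :: (l ++ t :: rs)) C = 0 := by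
  induction l generalizing C with
  | nil => exact rowMinor_cons_self hx (by simp [ht, htm]) rs hC
  | cons a l ih =>
    have ha := hl a (by simp)
    have h : -q • rowMinor q x (t :: a :: (l ++ t :: rs)) C = 0 := by
      rw [← rowMinor_swap hq hx ht ha.1 ha.2 _ hC, rowMinor_cons]
      refine sum_eq_zero fun c _ => ?_
      rw [ih (fun y hy => hl y (by simp [hy])) ((erase_subset _ _).trans hC), mul_zero, smul_zero]
    exact (smul_eq_zero_iff_right (neg_ne_zero.mpr hq)).mp h

lemma rowMinor_append_eq_zero (l : List ℕ) {rs : List ℕ}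
    (h : ∀ C ⊆ Icc 1 n, rowMinor q x rs C = 0) {C : Finset ℕ} (hC : C ⊆ Icc 1 n) :
    rowMinor q x (l ++ rs) C = 0 := by
  induction l generalizing C with
  | nil => exact h C hC
  | cons a l ih =>
    rw [List.cons_append, rowMinor_cons]
    exact sum_eq_zero fun c _ => by rw [ih ((erase_subset _ _).trans hC), mul_zero, smul_zero]

lemma rowMinor_append_mem (hq : q ≠ 0) (hx : IsQMatrix q m n x) {l : List ℕ}
    (hl : l.Pairwise (· < ·)) (hlm : ∀ y ∈ l, 1 ≤ y ∧ y ≤ m) {t : ℕ} (ht : t ∈ l) {C : Finset ℕ}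
    (hC : C ⊆ Icc 1 n) : rowMinor q x (l ++ [t]) C = 0 := by
  obtain ⟨l₁, l₂, rfl⟩ := List.append_of_mem ht
  rw [List.append_assoc, List.cons_append]
  refine rowMinor_append_eq_zero l₁ (fun D hD => ?_) hC
  refine rowMinor_eq_zero_of_lt hq hx (hlm t ht).1 l₂ [] (fun y hy => ?_) (hlm t ht).2 hD
  exact ⟨List.rel_of_pairwise_cons (List.pairwise_append.mp hl).2.1 hy, (hlm y (by simp [hy])).2⟩

lemma rowMinor_cons_mem (hq : q ≠ 0) (hx : IsQMatrix q m n x) {l : List ℕ}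
    (hl : l.Pairwise (· < ·)) (hlm : ∀ y ∈ l, 1 ≤ y ∧ y ≤ m) {t : ℕ} (ht : t ∈ l) {C : Finset ℕ}
    (hC : C ⊆ Icc 1 n) : rowMinor q x (t :: l) C = 0 := by
  induction l generalizing C with
  | nil => simp at ht
  | cons a l ih =>
    have ha := hlm a (by simp)
    rcases eq_or_ne t a with rfl | hta
    · exact rowMinor_cons_self hx (by simp [ha]) l hC
    have htl : t ∈ l := (List.mem_cons.mp ht).resolve_left hta
    rw [rowMinor_swap hq hx ha.1 (List.rel_of_pairwise_cons hl htl) (hlm t ht).2 l hC,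
      ← List.singleton_append, rowMinor_append_eq_zero [a] (fun D hD => ?_) hC, smul_zero]
    exact ih hl.of_cons (fun y hy => hlm y (by simp [hy])) htl hD

lemma rowMinor_cons_eq_orderedInsert (hq : q ≠ 0) (hx : IsQMatrix q m n x) {l : List ℕ}
    (hl : l.Pairwise (· < ·)) (hlm : ∀ y ∈ l, 1 ≤ y ∧ y ≤ m) {t : ℕ} (ht : t ∉ l) (htm : t ≤ m)
    {C : Finset ℕ} (hC : C ⊆ Icc 1 n) :
    rowMinor q x (t :: l) C =
      (-q) ^ numBelow l.toFinset t • rowMinor q x (l.orderedInsert (· ≤ ·) t) C := by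
  induction l generalizing C with
  | nil => simp [numBelow]
  | cons a l ih =>
    have ha := hlm a (by simp)
    have hal := List.pairwise_cons.mp hl
    rw [List.mem_cons, not_or] at ht
    rcases lt_or_gt_of_ne ht.1 with h | h
    · rw [List.orderedInsert_cons_of_le _ _ h.le, numBelow, filter_false_of_mem, card_empty,
        pow_zero, one_smul]
      intro y hy
      rw [List.mem_toFinset, List.mem_cons] at hy
      rcases hy with rfl | hy
      · exact h.not_gt
      · exact (h.trans (hal.1 y hy)).not_gt
    · rw [List.orderedInsert_of_not_le (r := (· ≤ ·)) _ h.not_ge,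
        rowMinor_swap hq hx ha.1 h htm l hC,
        numBelow_eq_erase (a := a) (by simp), if_pos h, pow_succ', mul_smul, rowMinor_cons,
        rowMinor_cons, List.toFinset_cons, erase_insert (by simpa using fun h => (hal.1 a h).false),
        smul_sum (r := (-q) ^ _)]
      congr 1
      refine sum_congr rfl fun c _ => ?_
      rw [ih hal.2 (fun y hy => hlm y (by simp [hy])) ht.2 ((erase_subset _ _).trans hC),
        mul_smul_comm, smul_comm]

lemma IsQMatrix.transpose (hx : IsQMatrix q m n x) : IsQMatrix q n m (fun a b => x b a) :=
  ⟨fun i j k h1 h2 h3 h4 h5 => hx.2.1 j k i h3 h4 h5 h1 h2,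
    fun i l j h1 h2 h3 h4 h5 => hx.1 j i l h4 h5 h1 h2 h3,
    fun i l j k h1 h2 h3 h4 h5 h6 => (hx.2.2.1 j k i l h4 h5 h6 h1 h2 h3).symm,
    fun i l j k h1 h2 h3 h4 h5 h6 => by
      rw [hx.2.2.1 j k i l h4 h5 h6 h1 h2 h3 |>.symm]
      exact hx.2.2.2 j k i l h4 h5 h6 h1 h2 h3⟩

lemma rowMinor_cons_insert (r a : ℕ) (rs : List ℕ) {C : Finset ℕ} (ha : ∀ c ∈ C, a < c) :
    rowMinor q x (r :: rs) (insert a C) = x r a * rowMinor q x rs C +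
      ∑ c ∈ C, (-q) ^ (numBelow C c + 1) • (x r c * rowMinor q x rs (insert a (C.erase c))) := by
  have haC : a ∉ C := fun h => (ha a h).false
  have h0 : numBelow (insert a C) a = 0 := by
    rw [numBelow, filter_false_of_mem, card_empty]
    intro y hy
    rcases mem_insert.mp hy with rfl | hy
    · exact lt_irrefl _
    · exact (ha y hy).not_gt
  rw [rowMinor_cons, sum_insert haC, h0, pow_zero, one_smul, erase_insert haC]
  congr 1
  refine sum_congr rfl fun c hc => ?_
  rw [numBelow_eq_erase (mem_insert_self a C), erase_insert haC, if_pos (ha c hc),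
    erase_insert_of_ne (ha c hc).ne]

lemma toFinset_erase {l : List ℕ} (hl : l.Nodup) (a : ℕ) :
    (l.erase a).toFinset = l.toFinset.erase a := by
  ext b
  simp [hl.mem_erase_iff]

/-- Transposition invariance: the row and column expansions of a quantum minor agree. -/
lemma rowMinor_transpose (hx : IsQMatrix q m n x) {R C : List ℕ}
    (hR : R.Pairwise (· < ·)) (hC : C.Pairwise (· < ·)) (hRm : ∀ r ∈ R, 1 ≤ r ∧ r ≤ m)
    (hCn : ∀ c ∈ C, 1 ≤ c ∧ c ≤ n) :
    rowMinor q x R C.toFinset = rowMinor q (fun a b => x b a) C R.toFinset := by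
  induction hN : R.length using Nat.strong_induction_on generalizing R C with | _ N ih
  subst hN
  cases R with
  | nil =>
    cases C with
    | nil => rfl
    | cons c C => rw [List.toFinset_nil, rowMinor_cons_empty, rowMinor_nil, if_neg (by simp)]
  | cons r R =>
    cases C with
    | nil => rw [List.toFinset_nil, rowMinor_cons_empty, rowMinor_nil, if_neg (by simp)]
    | cons c C =>
      obtain ⟨hrR, hR⟩ := List.pairwise_cons.mp hR
      obtain ⟨hcC, hC⟩ := List.pairwise_cons.mp hC
      obtain ⟨hr, hRm⟩ := List.forall_mem_cons.mp hRm
      obtain ⟨hc, hCn⟩ := List.forall_mem_cons.mp hCn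
      have hRN : R.length < (r :: R).length := Nat.lt_add_one _
      have hRd : R.Nodup := hR.imp ne_of_lt
      have hCd : C.Nodup := hC.imp ne_of_lt
      rw [List.toFinset_cons, List.toFinset_cons,
        rowMinor_cons_insert _ _ _ (by simpa using hcC),
        rowMinor_cons_insert _ _ _ (by simpa using hrR), ih _ hRN hR hC hRm hCn rfl]
      congr 1
      have hleft : ∀ a ∈ C.toFinset, rowMinor q x R (insert c (C.toFinset.erase a)) =
          ∑ t ∈ R.toFinset, (-q) ^ numBelow R.toFinset t •
            (x t c * rowMinor q (fun a b => x b a) (C.erase a) (R.toFinset.erase t)) := by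
        intro a _
        rw [← toFinset_erase hCd, ← List.toFinset_cons, ih _ hRN hR
          (List.pairwise_cons.mpr ⟨fun y hy => hcC y (List.mem_of_mem_erase hy),
            hC.sublist List.erase_sublist⟩) hRm
          (List.forall_mem_cons.mpr ⟨hc, fun y hy => hCn y (List.mem_of_mem_erase hy)⟩) rfl,
          rowMinor_cons]
      have hright : ∀ t ∈ R.toFinset,
          rowMinor q (fun a b => x b a) C (insert r (R.toFinset.erase t)) =
          ∑ a ∈ C.toFinset, (-q) ^ numBelow C.toFinset a •
            (x r a * rowMinor q (fun a b => x b a) (C.erase a) (R.toFinset.erase t)) := by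
        intro t ht
        have ht := List.mem_toFinset.mp ht
        have hlen : (R.erase t).length + 1 = R.length := List.length_erase_add_one ht
        have hRt := hR.sublist (List.erase_sublist (a := t))
        have hRtm : ∀ y ∈ R.erase t, 1 ≤ y ∧ y ≤ m := fun y hy => hRm y (List.mem_of_mem_erase hy)
        rw [← toFinset_erase hRd, ← List.toFinset_cons, ← ih _ hRN
          (List.pairwise_cons.mpr ⟨fun y hy => hrR y (List.mem_of_mem_erase hy), hRt⟩) hC
          (List.forall_mem_cons.mpr ⟨hr, hRtm⟩) hCn hlen, rowMinor_cons]
        refine sum_congr rfl fun a _ => ?_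
        rw [← toFinset_erase hCd, ih _ (by simp; omega) hRt (hC.sublist List.erase_sublist) hRtm
          (fun y hy => hCn y (List.mem_of_mem_erase hy)) rfl]
      rw [sum_congr rfl fun a (ha : a ∈ C.toFinset) => by rw [hleft a ha, mul_sum, smul_sum],
        sum_congr rfl fun t (ht : t ∈ R.toFinset) => by rw [hright t ht, mul_sum, smul_sum], sum_comm]
      refine sum_congr rfl fun t ht => sum_congr rfl fun a ha => ?_
      have hcomm : x r a * x t c = x t c * x r a := hx.2.2.1 r t c a hr.1
        (hrR t (List.mem_toFinset.mp ht)) (hRm t (List.mem_toFinset.mp ht)).2 hc.1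
        (hcC a (List.mem_toFinset.mp ha)) (hCn a (List.mem_toFinset.mp ha)).2
      simp only [mul_smul_comm, smul_smul, ← mul_assoc, hcomm]
      congr 1
      ring

lemma numBelow_orderEmbOfFin {k : ℕ} {J : Finset ℕ} (h : J.card = k) (p : Fin k) :
    numBelow J (J.orderEmbOfFin h p) = p := by
  have key (c : ℕ) : numBelow J c = #{a : Fin k | J.orderEmbOfFin h a < c} := by
    conv_lhs => rw [numBelow, ← map_orderEmbOfFin_univ J h, filter_map, card_map]
    rfl
  rw [key, ← Fin.card_Iio p]
  congr 1
  ext a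
  simp

/-- The permutation sending `0` to `p` and acting on the remaining elements like `τ`. -/
def consPerm {k : ℕ} (p : Fin (k + 1)) (τ : Equiv.Perm (Fin k)) : Equiv.Perm (Fin (k + 1)) :=
  (finSuccEquiv k).trans ((Equiv.optionCongr τ).trans (finSuccEquiv' p).symm)

lemma consPerm_zero {k : ℕ} (p : Fin (k + 1)) (τ : Equiv.Perm (Fin k)) :
    consPerm p τ 0 = p := by
  simp [consPerm]

lemma consPerm_succ {k : ℕ} (p : Fin (k + 1)) (τ : Equiv.Perm (Fin k)) (d : Fin k) :
    consPerm p τ d.succ = p.succAbove (τ d) := by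
  simp [consPerm]

lemma bijective_consPerm (k : ℕ) :
    Function.Bijective fun a : Fin (k + 1) × Equiv.Perm (Fin k) => consPerm a.1 a.2 := by
  rw [Fintype.bijective_iff_injective_and_card]
  refine ⟨fun a b hab => ?_, by simp [Fintype.card_perm, Nat.factorial_succ]⟩
  have h0 : a.1 = b.1 := by
    simpa only [consPerm_zero] using congrArg (fun σ : Equiv.Perm (Fin (k + 1)) => σ 0) hab
  refine Prod.ext h0 (Equiv.ext fun d => ?_)
  have h := congrArg (fun σ : Equiv.Perm (Fin (k + 1)) => σ d.succ) hab
  simp only [consPerm_succ, h0] at h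
  exact Fin.succAbove_right_injective h

lemma permInversions_eq_sum {k : ℕ} (σ : Equiv.Perm (Fin k)) :
    permInversions σ = ∑ a, ∑ b, if a < b ∧ σ b < σ a then 1 else 0 := by
  rw [permInversions, card_filter, Fintype.sum_prod_type]

lemma permInversions_consPerm {k : ℕ} (p : Fin (k + 1)) (τ : Equiv.Perm (Fin k)) :
    permInversions (consPerm p τ) = p + permInversions τ := by
  simp only [permInversions_eq_sum, Fin.sum_univ_succ, consPerm_zero, consPerm_succ,
    Fin.succ_lt_succ_iff, Fin.succAbove_lt_succAbove_iff, Fin.succ_pos, Fin.not_lt_zero,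
    true_and, false_and, if_false, zero_add]
  congr 1
  rw [Equiv.sum_comp τ fun d => if p.succAbove d < p then 1 else 0, ← card_filter]
  simp only [Fin.succAbove_lt_iff_castSucc_lt]
  rw [← card_map Fin.valEmbedding, show map Fin.valEmbedding _ = range p by
    ext a
    simp only [mem_map, mem_filter, mem_univ, true_and, Fin.valEmbedding_apply, mem_range]
    exact ⟨by rintro ⟨b, hb, rfl⟩; exact hb, fun ha => ⟨⟨a, by omega⟩, ha, rfl⟩⟩, card_range]

lemma sum_perm_eq_rowMinor {k : ℕ} (f : Fin k → ℕ) {J : Finset ℕ} (h : J.card = k) :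
    ∑ σ : Equiv.Perm (Fin k), (-q) ^ permInversions σ •
      (List.ofFn fun d => x (f d) (J.orderEmbOfFin h (σ d))).prod =
      rowMinor q x (List.ofFn f) J := by
  induction k generalizing J with
  | zero => simp [permInversions, rowMinor, card_eq_zero.mp h]
  | succ k ih =>
    rw [List.ofFn_succ, rowMinor_cons]
    conv_rhs => rw [← map_orderEmbOfFin_univ J h]
    rw [sum_map, ← (bijective_consPerm k).sum_comp, Fintype.sum_prod_type]
    simp only [map_orderEmbOfFin_univ]
    refine sum_congr rfl fun p _ => ?_
    set c := J.orderEmbOfFin h p with hc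
    have hcJ : c ∈ J := orderEmbOfFin_mem J h p
    have hcard : (J.erase c).card = k := by rw [card_erase_of_mem hcJ, h, Nat.add_sub_cancel]
    have hemb : ∀ d, J.orderEmbOfFin h (p.succAbove d) = (J.erase c).orderEmbOfFin hcard d := by
      refine congrFun (orderEmbOfFin_unique hcard (fun d => ?_) fun a b hab => ?_)
      · refine mem_erase.mpr ⟨fun hd => ?_, orderEmbOfFin_mem J h _⟩
        exact Fin.succAbove_ne p d ((J.orderEmbOfFin h).injective hd)
      · exact (J.orderEmbOfFin h).strictMono (Fin.strictMono_succAbove p hab)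
    change _ = (-q) ^ numBelow J c • (x (f 0) c * rowMinor q x _ (J.erase c))
    rw [← ih (fun d => f d.succ) hcard, mul_sum, smul_sum,
      show numBelow J c = p from numBelow_orderEmbOfFin h p]
    refine sum_congr rfl fun τ _ => ?_
    simp only [List.ofFn_succ, List.prod_cons, consPerm_zero, consPerm_succ,
      permInversions_consPerm, hemb, ← hc, mul_smul_comm, smul_smul, pow_add]

lemma flagMinor_eq_rowMinor (J : Finset ℕ) :
    flagMinor q x J = rowMinor q x (Icc 1 J.card).sort J := by
  have h : (Icc 1 J.card).card = J.card := by simp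
  rw [flagMinor, qMinor, dif_pos h, sum_perm_eq_rowMinor _ h.symm]
  congr 1
  refine List.ext_getElem (by simp) fun i _ _ => ?_
  simp [orderEmbOfFin_apply]

lemma orderedInsert_sort {I : Finset ℕ} {a : ℕ} (ha : a ∉ I) :
    I.sort.orderedInsert (· ≤ ·) a = (insert a I).sort := by
  refine List.Perm.eq_of_pairwise' ((pairwise_sort I (· ≤ ·)).orderedInsert _ _)
    (pairwise_sort _ _) ?_
  refine (List.perm_ext_iff_of_nodup ?_ (sort_nodup _ _)).mpr fun b => by simp
  rw [(List.perm_orderedInsert _ _ _).nodup_iff]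
  simp [ha]

lemma rowMinor_transpose_cons_sort (hq : q ≠ 0) (hx : IsQMatrix q m n x) {I : Finset ℕ}
    (hI : I ⊆ Icc 1 n) (hm : I.card + 1 ≤ m) {a : ℕ} (ha : a ∈ Icc 1 n) :
    rowMinor q (fun s t => x t s) (a :: I.sort) (Icc 1 (I.card + 1)) =
      if a ∈ I then 0 else (-q) ^ numBelow I a • flagMinor q x (insert a I) := by
  have hR : Icc 1 (I.card + 1) ⊆ Icc 1 m := Icc_subset_Icc_right hm
  have hIn : ∀ y ∈ I.sort, 1 ≤ y ∧ y ≤ n := fun y hy => mem_Icc.mp (hI ((mem_sort _).mp hy))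
  split_ifs with haI
  · exact rowMinor_cons_mem hq hx.transpose I.sortedLT_sort.pairwise hIn (by simpa using haI) hR
  · rw [rowMinor_cons_eq_orderedInsert hq hx.transpose I.sortedLT_sort.pairwise hIn
      (by simpa using haI) (mem_Icc.mp ha).2 hR, sort_toFinset, orderedInsert_sort haI,
      flagMinor_eq_rowMinor, card_insert_of_notMem haI]
    have h := rowMinor_transpose hx (sortedLT_sort (Icc 1 (I.card + 1))).pairwise
      (sortedLT_sort (insert a I)).pairwise
      (fun y hy => mem_Icc.mp (hR ((mem_sort _).mp hy)))
      (fun y hy => mem_Icc.mp (insert_subset ha hI ((mem_sort _).mp hy)))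
    rw [sort_toFinset, sort_toFinset] at h
    rw [h]

/-- The quantum Plücker relations between flag quantum minors. -/
theorem flagMinor_plucker (hq : q ≠ 0) (hx : IsQMatrix q m n x) {I J : Finset ℕ}
    (hI : I ⊆ Icc 1 n) (hJ : J ⊆ Icc 1 n) (hIJ : I.card + 2 ≤ J.card) (hm : J.card ≤ m + 1) :
    ∑ a ∈ J \ I, (-q) ^ (numAbove J a + numBelow I a) •
      (flagMinor q x (J.erase a) * flagMinor q x (insert a I)) = 0 := by
  set R := Icc 1 (I.card + 1)
  set N := (Icc 1 (J.card - 1)).sort with hN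
  have hG : ∀ a ∈ J, rowMinor q (fun s t => x t s) (a :: I.sort) R =
      if a ∈ I then 0 else (-q) ^ numBelow I a • flagMinor q x (insert a I) :=
    fun a ha => rowMinor_transpose_cons_sort hq hx hI (by omega) (hJ ha)
  have hzero : ∀ t ∈ R, rowMinor q x (N ++ [t]) J = 0 := by
    intro t ht
    have ht := mem_Icc.mp ht
    refine rowMinor_append_mem hq hx (sortedLT_sort _).pairwise (fun y hy => ?_)
      ((mem_sort _).mpr (mem_Icc.mpr ⟨ht.1, by omega⟩)) hJ
    have hy := mem_Icc.mp ((mem_sort _).mp hy)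
    omega
  calc
    _ = ∑ a ∈ J, (-q) ^ numAbove J a •
        (rowMinor q x N (J.erase a) * rowMinor q (fun s t => x t s) (a :: I.sort) R) := by
      rw [sdiff_eq_filter, sum_filter]
      refine sum_congr rfl fun a ha => ?_
      rw [hG a ha, flagMinor_eq_rowMinor (J.erase a), card_erase_of_mem ha]
      by_cases haI : a ∈ I
      · simp [haI]
      · simp only [haI, not_false_eq_true, if_true, if_false, mul_smul_comm, smul_smul, pow_add, hN]
    _ = ∑ t ∈ R, (-q) ^ numBelow R t • (rowMinor q x (N ++ [t]) J *
        rowMinor q (fun s t => x t s) I.sort (R.erase t)) := by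
      simp only [rowMinor_cons, rowMinor_append_singleton, mul_sum, sum_mul, smul_sum]
      rw [sum_comm]
      refine sum_congr rfl fun t _ => sum_congr rfl fun a _ => ?_
      simp only [mul_smul_comm, smul_mul_assoc, mul_assoc]
      rw [smul_comm]
    _ = 0 := sum_eq_zero fun t ht => by rw [hzero t ht, zero_mul, smul_zero]

end RowExpansion

lemma numBelow_add_numAbove {C : Finset ℕ} {a : ℕ} (ha : a ∉ C) :
    numBelow C a + numAbove C a = C.card := by
  rw [numBelow, numAbove, ← card_union_of_disjoint (by rw [disjoint_left]; simp; grind)]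
  congr 1
  ext b
  simp only [mem_union, mem_filter]
  grind

lemma numAbove_insert {C : Finset ℕ} {a : ℕ} (ha : a ∉ C) (c : ℕ) :
    numAbove (insert a C) c = numAbove C c + if c < a then 1 else 0 := by
  rw [numAbove_eq_erase (mem_insert_self a C), erase_insert ha]

/-- The quantized Plücker-type relation `[Xik][Xj] = q⁻¹[Xij][Xk] + q[Xjk][Xi]`. -/
theorem flag_triple_identity_b
    {K A : Type} [Field K] [Ring A] [Algebra K A] {m n : ℕ}
    (q : K) (hq : q ≠ 0) (x : ℕ → ℕ → A) (hx : IsQMatrix q m n x)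
    (i j k : ℕ) (h1i : 1 ≤ i) (hij : i < j) (hjk : j < k) (hkn : k ≤ n)
    (X : Finset ℕ) (hXn : X ⊆ Finset.Icc 1 n)
    (hiX : i ∉ X) (hjX : j ∉ X) (hkX : k ∉ X)
    (hm : X.card + 2 ≤ m) :
    flagMinor q x (insert i (insert k X)) * flagMinor q x (insert j X) =
      q⁻¹ • (flagMinor q x (insert i (insert j X)) * flagMinor q x (insert k X)) +
        q • (flagMinor q x (insert j (insert k X)) * flagMinor q x (insert i X)) := by
  have hX : X ∪ {i, j, k} ⊆ Icc 1 n := by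
    refine union_subset hXn fun a ha => mem_Icc.mpr ?_
    simp only [mem_insert, mem_singleton] at ha
    omega
  have hJX : insert i (insert j (insert k X)) = X ∪ {i, j, k} := by
    ext a
    simp only [mem_insert, mem_union, mem_singleton]
    tauto
  have hj : j ∉ insert k X := by simp [hjk.ne, hjX]
  have hi : i ∉ insert j (insert k X) := by simp [hij.ne, (hij.trans hjk).ne, hiX]
  have hcard : (insert i (insert j (insert k X))).card = X.card + 3 := by
    rw [card_insert_of_notMem hi, card_insert_of_notMem hj, card_insert_of_notMem hkX]
  have h := flagMinor_plucker hq hx hXn (hJX ▸ hX) (by omega) (by omega)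
  have hsdiff : insert i (insert j (insert k X)) \ X = {i, j, k} := by
    ext a
    simp only [mem_sdiff, mem_insert, mem_singleton]
    grind
  have hei : (insert i (insert j (insert k X))).erase i = insert j (insert k X) :=
    erase_insert hi
  have hej : (insert i (insert j (insert k X))).erase j = insert i (insert k X) := by
    rw [erase_insert_of_ne hij.ne, erase_insert hj]
  have hek : (insert i (insert j (insert k X))).erase k = insert i (insert j X) := by
    rw [erase_insert_of_ne (hij.trans hjk).ne, erase_insert_of_ne hjk.ne, erase_insert hkX]
  have hni := numBelow_add_numAbove hiX
  have hnj := numBelow_add_numAbove hjX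
  have hnk := numBelow_add_numAbove hkX
  have hai : numAbove (insert i (insert j (insert k X))) i + numBelow X i = X.card + 2 := by
    simp only [numAbove_insert hi, numAbove_insert hj, numAbove_insert hkX]
    grind
  have haj : numAbove (insert i (insert j (insert k X))) j + numBelow X j = X.card + 1 := by
    simp only [numAbove_insert hi, numAbove_insert hj, numAbove_insert hkX]
    grind
  have hak : numAbove (insert i (insert j (insert k X))) k + numBelow X k = X.card := by
    simp only [numAbove_insert hi, numAbove_insert hj, numAbove_insert hkX]
    grind
  rw [hsdiff, sum_insert (by simp; omega), sum_insert (by simp; omega), sum_singleton,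
    hei, hej, hek, hai, haj, hak, pow_add, pow_add, mul_smul, mul_smul, ← smul_add, ← smul_add,
    smul_eq_zero_iff_right (pow_ne_zero _ (neg_ne_zero.mpr hq))] at h
  refine smul_right_injective A hq (sub_eq_zero.mp (Eq.trans ?_ (neg_eq_zero.mpr h)))
  match_scalars <;> field_simp
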